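/- arXiv:1811.07076 — 3 statements merged into one kernel-verified Lean document; each statement's English description precedes it below -/
import Mathlib

section
/- Let K be an abstract simplicial complex on the vertex set Fin m, let X be a topological space, A ⊆ X a subset, and let G be a subgroup of Equiv.Perm (Fin m) acting on K. Then the G-fixed point set Z(K;(X,A))^G = {f ∈ Z(K;(X,A)) | ∀ g ∈ G, ∀ i, f (g⁻¹ i) = f i}, with the subspace topology inherited from (Fin m → X), is homeomorphic to the product Z(K//G;(X,A)) × (Fin k_G → A), where Z(K//G;(X,A)) is the polyhedral product of the strong quotient K//G regarded as a subspace of (V_G → X). In other words, Z(K;(X,A))^G ≅ Z(K//G;(X,A)) × A^{k_G}. -/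
open Classical

/-- The orbit of `i` under a subgroup `G ≤ Perm (Fin m)`, regarded as a finset of `Fin m`. -/
noncomputable def orbitFinset {m : ℕ} (G : Subgroup (Equiv.Perm (Fin m))) (i : Fin m) :
    Finset (Fin m) :=
  Finset.filter (fun j => ∃ g ∈ G, g i = j) Finset.univ

theorem mem_orbitFinset {m : ℕ} {G : Subgroup (Equiv.Perm (Fin m))} {i j : Fin m} :
    j ∈ orbitFinset G i ↔ ∃ g ∈ G, g i = j := by
  simp [orbitFinset]

theorem self_mem_orbitFinset {m : ℕ} (G : Subgroup (Equiv.Perm (Fin m))) (i : Fin m) :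
    i ∈ orbitFinset G i :=
  mem_orbitFinset.2 ⟨1, G.one_mem, rfl⟩

theorem orbitFinset_eq_of_mem {m : ℕ} {G : Subgroup (Equiv.Perm (Fin m))} {i j : Fin m}
    (h : j ∈ orbitFinset G i) : orbitFinset G j = orbitFinset G i := by
  obtain ⟨g, hg, rfl⟩ := mem_orbitFinset.1 h
  ext k
  rw [mem_orbitFinset, mem_orbitFinset]
  constructor
  · rintro ⟨a, ha, rfl⟩
    exact ⟨a * g, G.mul_mem ha hg, rfl⟩
  · rintro ⟨a, ha, rfl⟩
    exact ⟨a * g⁻¹, G.mul_mem ha (G.inv_mem hg), by simp⟩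

theorem eq_of_mem_orbitFinset {m : ℕ} {G : Subgroup (Equiv.Perm (Fin m))} {X : Type*}
    {f : Fin m → X} (hf : ∀ g ∈ G, ∀ i : Fin m, f (g⁻¹ i) = f i) {i j : Fin m}
    (h : j ∈ orbitFinset G i) : f j = f i := by
  obtain ⟨g, hg, rfl⟩ := mem_orbitFinset.1 h
  simpa using hf g⁻¹ (G.inv_mem hg) i

/-- Fixed point theorem for polyhedral products: the `G`-fixed point set of `Z(K;(X,A))`
(with the subspace topology from `Fin m → X`) is homeomorphic to
`Z(K//G;(X,A)) × A^{k_G}`, where `K//G` is the strong quotient on the vertex set `V_G` of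
`G`-orbit finsets belonging to `K`, and `k_G` is the number of `G`-orbit finsets not
belonging to `K`. -/
theorem polyhedral_product_fixedPoints_homeomorph {m : ℕ} (K : Set (Finset (Fin m)))
    (hK : ∀ σ ∈ K, ∀ τ ⊆ σ, τ ∈ K) (hKempty : (∅ : Finset (Fin m)) ∈ K)
    {X : Type*} [TopologicalSpace X] (A : Set X)
    (G : Subgroup (Equiv.Perm (Fin m)))
    (hG : ∀ g ∈ G, ∀ σ ∈ K, σ.image g ∈ K) :
    Nonempty (
      -- the `G`-fixed point set `Z(K;(X,A))^G`
      {f : Fin m → X // Finset.filter (fun i => f i ∉ A) Finset.univ ∈ K ∧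
          ∀ g ∈ G, ∀ i : Fin m, f (g⁻¹ i) = f i} ≃ₜ
      -- `Z(K//G;(X,A)) × A^{k_G}`
      ({h : {v : Finset (Fin m) // (∃ i, v = orbitFinset G i) ∧ v ∈ K} → X //
          Finset.filter
            (fun i => ∃ v : {v : Finset (Fin m) // (∃ i, v = orbitFinset G i) ∧ v ∈ K},
              i ∈ v.1 ∧ h v ∉ A) Finset.univ ∈ K} ×
        (Fin (Nat.card {v : Finset (Fin m) // (∃ i, v = orbitFinset G i) ∧ v ∉ K}) → A))) := by
  have hrep : ∀ v : Finset (Fin m), (∃ i, v = orbitFinset G i) → ∃ i ∈ v, v = orbitFinset G i := by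
    rintro _ ⟨i, rfl⟩
    exact ⟨i, self_mem_orbitFinset G i, rfl⟩
  choose r hrmem hr using hrep
  let e := (Finite.equivFin {v : Finset (Fin m) // (∃ i, v = orbitFinset G i) ∧ v ∉ K}).symm
  have hrf : ∀ (f : Fin m → X), (∀ g ∈ G, ∀ i : Fin m, f (g⁻¹ i) = f i) →
      ∀ v hv, ∀ i ∈ v, f i = f (r v hv) := fun f hf v hv i hi =>
    eq_of_mem_orbitFinset hf (hr v hv ▸ hi)
  have hself : ∀ v hv, orbitFinset G (r v hv) = v := fun v hv => (hr v hv).symm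
  refine ⟨{
    toFun := fun f => (⟨fun v => f.1 (r v.1 v.2.1), ?_⟩,
      fun k => ⟨f.1 (r (e k).1 (e k).2.1), ?_⟩)
    invFun := fun p => ⟨fun i =>
      if hi : orbitFinset G i ∈ K then p.1.1 ⟨orbitFinset G i, ⟨i, rfl⟩, hi⟩
      else p.2 (e.symm ⟨orbitFinset G i, ⟨i, rfl⟩, hi⟩), ?_, ?_⟩
    left_inv := ?_
    right_inv := ?_
    continuous_toFun := ?_
    continuous_invFun := ?_ }⟩
  · refine hK _ f.2.1 _ fun i hi => ?_
    simp only [Finset.mem_filter, Finset.mem_univ, true_and] at hi ⊢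
    obtain ⟨v, hiv, hv⟩ := hi
    rwa [hrf f.1 f.2.2 v.1 v.2.1 i hiv]
  · by_contra hA
    refine (e k).2.2 (hK _ f.2.1 _ fun i hi => ?_)
    simp only [Finset.mem_filter, Finset.mem_univ, true_and]
    rwa [hrf f.1 f.2.2 _ (e k).2.1 i hi]
  · refine hK _ p.1.2 _ fun i hi => ?_
    simp only [Finset.mem_filter, Finset.mem_univ, true_and] at hi ⊢
    split_ifs at hi with h
    · exact ⟨_, self_mem_orbitFinset G i, hi⟩
    · exact absurd (Subtype.coe_prop _) hi
  · intro g hg i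
    have h : orbitFinset G (g⁻¹ i) = orbitFinset G i :=
      orbitFinset_eq_of_mem (mem_orbitFinset.2 ⟨g⁻¹, G.inv_mem hg, rfl⟩)
    simp only [h]
  · intro f
    ext i
    have h := hrf f.1 f.2.2 (orbitFinset G i) ⟨i, rfl⟩ i (self_mem_orbitFinset G i)
    by_cases hi : orbitFinset G i ∈ K <;> simp [hi, h.symm]
  · rintro ⟨h, a⟩
    refine Prod.ext (Subtype.ext (funext fun v => ?_)) (funext fun k => Subtype.ext ?_)
    · simp [hself, v.2.2]
    · simp [hself, (e k).2.2]
  · refine Continuous.prodMk (Continuous.subtype_mk (continuous_pi fun v => ?_) _)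
      (continuous_pi fun k => Continuous.subtype_mk ?_ _)
    · exact (continuous_apply (r v.1 v.2.1)).comp continuous_subtype_val
    · exact (continuous_apply (r (e k).1 (e k).2.1)).comp continuous_subtype_val
  · refine Continuous.subtype_mk (continuous_pi fun i => ?_) _
    by_cases hi : orbitFinset G i ∈ K
    · simp only [hi, dite_true]
      exact (continuous_apply _).comp (continuous_subtype_val.comp continuous_fst)
    · simp only [hi, dite_false]
      fun_prop
end

section
/- Let K be an abstract simplicial complex on the vertex set Fin m and let G be a subgroup of Equiv.Perm (Fin m) acting on K. Let X = Set.Icc (-1 : ℝ) 1 with the subspace topology and A = {x ∈ X | x = -1 ∨ x = 1} its two-point boundary. Then the G-fixed point set of the real moment-angle complex Z(K;(D¹,S⁰)) is homeomorphic to the disjoint union of 2^{k_G} copies of the real moment-angle complex Z(K//G;(D¹,S⁰)); that is, Z(K;(D¹,S⁰))^G ≅ Fin (2^{k_G}) × Z(K//G;(D¹,S⁰)) where Fin (2^{k_G}) carries the discrete topology. -/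
open Classical

/-- `D¹ = [-1,1]` with the subspace topology. -/
abbrev D1 : Type := Set.Icc (-1 : ℝ) 1

/-- `S⁰ = {-1, 1} ⊆ D¹`. -/
def S0 : Set D1 := {x : D1 | (x : ℝ) = -1 ∨ (x : ℝ) = 1}

theorem apply_eq_of_mem_orbitFinset {m : ℕ} {X : Type*} {G : Subgroup (Equiv.Perm (Fin m))}
    {f : Fin m → X} (hf : ∀ g ∈ G, ∀ i, f (g⁻¹ i) = f i) {i j : Fin m}
    (h : j ∈ orbitFinset G i) : f j = f i := by
  obtain ⟨g, hg, rfl⟩ := mem_orbitFinset.1 h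
  simpa using (hf g hg (g i)).symm

theorem S0_eq_pair : S0 = {⟨-1, by norm_num⟩, ⟨1, by norm_num⟩} := by
  ext x
  simp [S0, Subtype.ext_iff]

instance finite_S0 : Finite S0 := by
  rw [S0_eq_pair]
  infer_instance

theorem natCard_S0 : Nat.card S0 = 2 := by
  rw [S0_eq_pair, Nat.card_coe_set_eq]
  exact Set.ncard_pair fun h => by norm_num [Subtype.ext_iff] at h

/-- Sign vectors indexed by a finite type form a discrete space with `2 ^ n` points. -/
noncomputable def signVectorsHomeomorph (B : Type*) [Finite B] :
    (B → S0) ≃ₜ Fin (2 ^ Nat.card B) :=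
  (Finite.equivFinOfCardEq (by rw [Nat.card_fun, natCard_S0])).toHomeomorphOfDiscrete

section Splitting

variable {m : ℕ} (K : Set (Finset (Fin m))) (G : Subgroup (Equiv.Perm (Fin m)))

/-- Extend values on the orbits in `K` and signs on the remaining orbits to all vertices. -/
noncomputable def orbitExtend
    (s : {v : Finset (Fin m) // (∃ i, v = orbitFinset G i) ∧ v ∉ K} → S0)
    (h : {v : Finset (Fin m) // (∃ i, v = orbitFinset G i) ∧ v ∈ K} → D1) (i : Fin m) : D1 :=
  if hi : orbitFinset G i ∈ K then h ⟨orbitFinset G i, ⟨i, rfl⟩, hi⟩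
  else s ⟨orbitFinset G i, ⟨i, rfl⟩, hi⟩

variable {K G}

theorem orbitExtend_of_mem {s h} {i : Fin m} (hi : orbitFinset G i ∈ K) :
    orbitExtend K G s h i = h ⟨orbitFinset G i, ⟨i, rfl⟩, hi⟩ :=
  dif_pos hi

theorem orbitExtend_of_notMem {s h} {i : Fin m} (hi : orbitFinset G i ∉ K) :
    orbitExtend K G s h i = s ⟨orbitFinset G i, ⟨i, rfl⟩, hi⟩ :=
  dif_neg hi

theorem orbitExtend_congr {s h} {i j : Fin m} (hij : orbitFinset G i = orbitFinset G j) :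
    orbitExtend K G s h i = orbitExtend K G s h j := by
  simp only [orbitExtend, hij]

theorem apply_mem_S0_of_orbitFinset_notMem (hK : ∀ σ ∈ K, ∀ τ ⊆ σ, τ ∈ K) {f : Fin m → D1}
    (hfK : Finset.filter (fun i => f i ∉ S0) Finset.univ ∈ K)
    (hf : ∀ g ∈ G, ∀ i, f (g⁻¹ i) = f i) {i : Fin m} (hi : orbitFinset G i ∉ K) :
    f i ∈ S0 := by
  by_contra hfi
  refine hi (hK _ hfK _ fun j hj => ?_)
  simpa [apply_eq_of_mem_orbitFinset hf hj] using hfi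

/-- A fixed point of the real moment-angle complex is a choice of signs on the orbits outside `K`
together with a point of the real moment-angle complex of the strong quotient. -/
noncomputable def fixedPointsHomeomorph (hK : ∀ σ ∈ K, ∀ τ ⊆ σ, τ ∈ K) :
    {f : Fin m → D1 // Finset.filter (fun i => f i ∉ S0) Finset.univ ∈ K ∧
        ∀ g ∈ G, ∀ i : Fin m, f (g⁻¹ i) = f i} ≃ₜ
      (({v : Finset (Fin m) // (∃ i, v = orbitFinset G i) ∧ v ∉ K} → S0) ×
        {h : {v : Finset (Fin m) // (∃ i, v = orbitFinset G i) ∧ v ∈ K} → D1 //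
          Finset.filter
            (fun i => ∃ v : {v : Finset (Fin m) // (∃ i, v = orbitFinset G i) ∧ v ∈ K},
              i ∈ v.1 ∧ h v ∉ S0) Finset.univ ∈ K}) where
  toFun f :=
    (fun v => ⟨f.1 v.2.1.choose, apply_mem_S0_of_orbitFinset_notMem hK f.2.1 f.2.2
        (v.2.1.choose_spec ▸ v.2.2)⟩,
      ⟨fun v => f.1 v.2.1.choose, hK _ f.2.1 _ fun i hi => by
        simp only [Finset.mem_filter, Finset.mem_univ, true_and] at hi ⊢
        obtain ⟨v, hiv, hv⟩ := hi
        rw [v.2.1.choose_spec] at hiv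
        rwa [apply_eq_of_mem_orbitFinset f.2.2 hiv]⟩)
  invFun p :=
    ⟨orbitExtend K G p.1 p.2.1, hK _ p.2.2 _ fun i hi => by
        simp only [Finset.mem_filter, Finset.mem_univ, true_and] at hi ⊢
        by_cases hiK : orbitFinset G i ∈ K
        · rw [orbitExtend_of_mem hiK] at hi
          exact ⟨_, self_mem_orbitFinset G i, hi⟩
        · rw [orbitExtend_of_notMem hiK] at hi
          exact absurd (Subtype.prop _) hi,
      fun g hg i => orbitExtend_congr <| orbitFinset_eq_of_mem <|
        mem_orbitFinset.2 ⟨g⁻¹, G.inv_mem hg, rfl⟩⟩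
  left_inv f := by
    refine Subtype.ext (funext fun i => ?_)
    have key (h : ∃ j, orbitFinset G i = orbitFinset G j) : f.1 h.choose = f.1 i :=
      (apply_eq_of_mem_orbitFinset f.2.2 (h.choose_spec ▸ self_mem_orbitFinset G i)).symm
    by_cases hi : orbitFinset G i ∈ K
    · exact (orbitExtend_of_mem hi).trans (key _)
    · exact (orbitExtend_of_notMem hi).trans (key _)
  right_inv p := by
    refine Prod.ext (funext fun v => Subtype.ext ?_) (Subtype.ext (funext fun v => ?_))
    · have hv := v.2.1.choose_spec
      refine (orbitExtend_of_notMem (hv ▸ v.2.2)).trans ?_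
      exact congrArg (fun w => (p.1 w : D1)) (Subtype.ext hv.symm)
    · have hv := v.2.1.choose_spec
      refine (orbitExtend_of_mem (hv ▸ v.2.2)).trans ?_
      exact congrArg p.2.1 (Subtype.ext hv.symm)
  continuous_toFun := by
    refine .prodMk (continuous_pi fun v => .subtype_mk ?_ _)
      (.subtype_mk (continuous_pi fun v => ?_) _) <;>
    exact (continuous_apply _).comp continuous_subtype_val
  continuous_invFun := by
    refine .subtype_mk (continuous_pi fun i => ?_) _
    by_cases hi : orbitFinset G i ∈ K
    · simp only [orbitExtend_of_mem hi]
      exact (continuous_apply _).comp (continuous_subtype_val.comp continuous_snd)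
    · simp only [orbitExtend_of_notMem hi]
      fun_prop

end Splitting

/-- The `G`-fixed point set of the real moment-angle complex `Z(K;(D¹,S⁰))` is homeomorphic
to the disjoint union of `2^{k_G}` copies of the real moment-angle complex
`Z(K//G;(D¹,S⁰))`, where `k_G` is the number of `G`-orbit finsets not belonging to `K`. -/
theorem realMomentAngle_fixedPoints_homeomorph {m : ℕ} (K : Set (Finset (Fin m)))
    (hK : ∀ σ ∈ K, ∀ τ ⊆ σ, τ ∈ K) (hKempty : (∅ : Finset (Fin m)) ∈ K)
    (G : Subgroup (Equiv.Perm (Fin m)))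
    (hG : ∀ g ∈ G, ∀ σ ∈ K, σ.image g ∈ K) :
    Nonempty (
      -- the `G`-fixed point set `Z(K;(D¹,S⁰))^G`
      {f : Fin m → D1 // Finset.filter (fun i => f i ∉ S0) Finset.univ ∈ K ∧
          ∀ g ∈ G, ∀ i : Fin m, f (g⁻¹ i) = f i} ≃ₜ
      -- `2^{k_G}` disjoint copies of `Z(K//G;(D¹,S⁰))`
      (Fin (2 ^ Nat.card {v : Finset (Fin m) // (∃ i, v = orbitFinset G i) ∧ v ∉ K}) ×
        {h : {v : Finset (Fin m) // (∃ i, v = orbitFinset G i) ∧ v ∈ K} → D1 //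
          Finset.filter
            (fun i => ∃ v : {v : Finset (Fin m) // (∃ i, v = orbitFinset G i) ∧ v ∈ K},
              i ∈ v.1 ∧ h v ∉ S0) Finset.univ ∈ K})) := by
  exact ⟨(fixedPointsHomeomorph hK).trans ((signVectorsHomeomorph _).prodCongr (.refl _))⟩
end

section
/- Let ∂Δ^m be the boundary of the m-simplex, i.e., the abstract simplicial complex on Fin (m+1) consisting of all finsets σ ≠ Finset.univ. With X = Set.Icc (-1 : ℝ) 1 and A = {-1, 1}, the polyhedral product Z(∂Δ^m;(D¹,S⁰)) is homeomorphic to the m-sphere, i.e., to Metric.sphere (0 : EuclideanSpace ℝ (Fin (m+1))) 1. -/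
open Classical

/-- The boundary `∂Δ^m` of the `m`-simplex: all finsets of `Fin (m+1)` except `univ`. -/
def simplexBoundary (m : ℕ) : Set (Finset (Fin (m + 1))) :=
  {σ : Finset (Fin (m + 1)) | σ ≠ Finset.univ}

/-- The inverse radial projection recovers a unit vector. -/
lemma ContinuousLinearEquiv.normalize_symm_normalize {E F : Type*} [NormedAddCommGroup E]
    [NormedSpace ℝ E] [NormedAddCommGroup F] [NormedSpace ℝ F] (e : E ≃L[ℝ] F) {x : E}
    (hx : ‖x‖ = 1) :
    ‖e.symm (‖e x‖⁻¹ • e x)‖⁻¹ • e.symm (‖e x‖⁻¹ • e x) = x := by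
  have hx0 : x ≠ 0 := by
    rintro rfl
    simp at hx
  have he : ‖e x‖ ≠ 0 := by simpa using hx0
  simp [norm_smul, hx, smul_smul, he]

/-- A continuous linear equivalence of normed spaces induces, by radial projection, a
homeomorphism of unit spheres. -/
noncomputable def ContinuousLinearEquiv.unitSphereHomeomorph {E F : Type*} [NormedAddCommGroup E]
    [NormedSpace ℝ E] [NormedAddCommGroup F] [NormedSpace ℝ F] (e : E ≃L[ℝ] F) :
    Metric.sphere (0 : E) 1 ≃ₜ Metric.sphere (0 : F) 1 where
  toFun x := ⟨‖e x‖⁻¹ • e x, by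
    have h : (e x : F) ≠ 0 := by simpa using ne_zero_of_mem_unit_sphere x
    simp [norm_smul, h]⟩
  invFun y := ⟨‖e.symm y‖⁻¹ • e.symm y, by
    have h : (e.symm y : E) ≠ 0 := by simpa using ne_zero_of_mem_unit_sphere y
    simp [norm_smul, h]⟩
  left_inv x := Subtype.ext (e.normalize_symm_normalize (norm_eq_of_mem_sphere x))
  right_inv y := Subtype.ext (e.symm.normalize_symm_normalize (norm_eq_of_mem_sphere y))
  continuous_toFun := by
    refine Continuous.subtype_mk (Continuous.smul (Continuous.inv₀ (by fun_prop) fun x => ?_)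
      (by fun_prop)) _
    simpa using ne_zero_of_mem_unit_sphere x
  continuous_invFun := by
    refine Continuous.subtype_mk (Continuous.smul (Continuous.inv₀ (by fun_prop) fun y => ?_)
      (by fun_prop)) _
    simpa using ne_zero_of_mem_unit_sphere y

/-- A vector has sup norm one iff its coordinates lie in `[-1, 1]` and one of them is `±1`. -/
lemma pi_norm_eq_one_iff {ι : Type*} [Fintype ι] (f : ι → ℝ) :
    ‖f‖ = 1 ↔ (∀ i, f i ∈ Set.Icc (-1 : ℝ) 1) ∧ ∃ i, f i = -1 ∨ f i = 1 := by
  have hle : ‖f‖ ≤ 1 ↔ ∀ i, f i ∈ Set.Icc (-1 : ℝ) 1 := by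
    simp [pi_norm_le_iff_of_nonneg, abs_le]
  rw [← hle]
  constructor
  · intro h
    refine ⟨h.le, ?_⟩
    by_contra! hne
    refine h.not_lt ((pi_norm_lt_iff one_pos).2 fun i => ?_)
    have hi := hle.1 h.le i
    rw [Real.norm_eq_abs, abs_lt]
    exact ⟨lt_of_le_of_ne hi.1 (hne i).1.symm, lt_of_le_of_ne hi.2 (hne i).2⟩
  · rintro ⟨h, i, hi⟩
    refine le_antisymm h ?_
    have habs : ‖f i‖ = 1 := by rcases hi with hi | hi <;> simp [hi]
    exact habs ▸ norm_le_pi_norm f i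

lemma filter_notMem_S0_mem_simplexBoundary_iff {m : ℕ} (f : Fin (m + 1) → D1) :
    Finset.filter (fun i => f i ∉ S0) Finset.univ ∈ simplexBoundary m ↔
      ‖fun i => (f i : ℝ)‖ = 1 := by
  have h : Finset.filter (fun i => f i ∉ S0) Finset.univ ∈ simplexBoundary m ↔
      ∃ i, f i ∈ S0 := by
    change ¬ Finset.filter (fun i => f i ∉ S0) Finset.univ = Finset.univ ↔ _
    simp only [Finset.filter_eq_self, Finset.mem_univ, true_implies, not_forall, not_not]
  rw [h, pi_norm_eq_one_iff]
  exact ⟨fun h => ⟨fun i => (f i).2, h⟩, fun h => h.2⟩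

/-- The real moment-angle complex of `∂Δ^m` is the unit sphere of the sup norm. -/
def realMomentAngleHomeomorphSupSphere (m : ℕ) :
    {f : Fin (m + 1) → D1 //
        Finset.filter (fun i => f i ∉ S0) Finset.univ ∈ simplexBoundary m} ≃ₜ
      Metric.sphere (0 : Fin (m + 1) → ℝ) 1 where
  toFun f := ⟨fun i => (f.1 i : ℝ), by
    simpa using (filter_notMem_S0_mem_simplexBoundary_iff f.1).1 f.2⟩
  invFun g := ⟨fun i => ⟨g.1 i, ((pi_norm_eq_one_iff g.1).1 (norm_eq_of_mem_sphere g)).1 i⟩,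
    (filter_notMem_S0_mem_simplexBoundary_iff _).2 (norm_eq_of_mem_sphere g)⟩
  left_inv _ := rfl
  right_inv _ := rfl
  continuous_toFun := Continuous.subtype_mk (continuous_pi fun i =>
    continuous_subtype_val.comp ((continuous_apply i).comp continuous_subtype_val)) _
  continuous_invFun := Continuous.subtype_mk (continuous_pi fun i =>
    Continuous.subtype_mk ((continuous_apply i).comp continuous_subtype_val) _) _

/-- The real moment-angle complex `Z(∂Δ^m;(D¹,S⁰))` is homeomorphic to the `m`-sphere. -/
theorem realMomentAngle_simplexBoundary_homeomorph_sphere (m : ℕ) :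
    Nonempty (
      {f : Fin (m + 1) → D1 //
          Finset.filter (fun i => f i ∉ S0) Finset.univ ∈ simplexBoundary m} ≃ₜ
      Metric.sphere (0 : EuclideanSpace ℝ (Fin (m + 1))) 1) :=
  ⟨(realMomentAngleHomeomorphSupSphere m).trans
    (EuclideanSpace.equiv (Fin (m + 1)) ℝ).symm.unitSphereHomeomorph⟩
end
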